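/- arXiv:2509.22610 — 2 statements merged into one kernel-verified Lean document; each statement's English description precedes it below -/
import Mathlib

section
/- Let (a_{−k−1})_{k≥0} be a sequence in ℚ((q)) satisfying the lower bound condition. Then the family of residue series (r_j)_{j∈ℤ} is summable in ℚ((q)) (its q-orders tend to +∞ as |j| → ∞) and Σ_{j∈ℤ} r_j = −a_{−1} (where a_{−1} is the k = 0 term of the sequence). -/
noncomputable section

/-- The Laurent series variable `q` of `ℚ((q))`. -/
def qq : LaurentSeries ℚ := HahnSeries.single 1 1

/-- `(q)_m = ∏_{i=1}^{m}(1−qⁱ)` in `ℚ((q))`. -/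
def qPoch (m : ℕ) : LaurentSeries ℚ := ∏ i ∈ Finset.range m, (1 - qq ^ (i + 1))

/-- `(q)_∞ = ∏_{i≥1}(1−qⁱ)` in `ℚ((q))` (a convergent infinite product for the
`q`-adic topology). -/
def qInf : LaurentSeries ℚ := ∏' i : ℕ, (1 - qq ^ (i + 1))

/-- `ρ_{k,j} = −(−1)^{k+j}·q^{k(k+1)/2+j(j+1)/2}·((q)_{k+j}(q)_{k−j})⁻¹` for
`k ≥ |j|` (and `0` for `k < |j|`). -/
def ρ (k : ℕ) (j : ℤ) : LaurentSeries ℚ :=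
  if (k : ℤ) < |j| then 0
  else -((-1 : LaurentSeries ℚ) ^ ((k : ℤ) + j) *
    qq ^ ((k : ℤ) * ((k : ℤ) + 1) / 2 + j * (j + 1) / 2) *
    (qPoch ((k : ℤ) + j).toNat * qPoch ((k : ℤ) - j).toNat)⁻¹)

/-- The lower bound condition: `δ(a_{−k−1}) ≥ −(k+1)(k−2)/2 + C` for all `k ≥ 0`
(stated coefficientwise, which also covers vanishing terms). -/
def LBC (a : ℕ → LaurentSeries ℚ) (C : ℤ) : Prop :=
  ∀ k : ℕ, ∀ w : ℤ, 2 * w < -(((k : ℤ) + 1) * ((k : ℤ) - 2)) + 2 * C → (a k).coeff w = 0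

/-- The residue series `r_j = Σ_{k≥|j|} a_{−k−1}·ρ_{k,j}`. -/
def resid (a : ℕ → LaurentSeries ℚ) (j : ℤ) : LaurentSeries ℚ := ∑' k : ℕ, a k * ρ k j

/-- The balanced Gaussian binomial `binom[k+i, 2k]`, as a Laurent polynomial in `q`:
`binom[k+i,2k] = q^{k(k−i)}·∏_{j=0}^{2k−1}(q^{k+i−j}−1) / ∏_{j=0}^{2k−1}(q^{2k−j}−1)`. -/
def bq (i k : ℕ) : LaurentSeries ℚ :=
  qq ^ ((k : ℤ) * ((k : ℤ) - (i : ℤ))) *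
    (∏ j ∈ Finset.range (2 * k), (qq ^ ((k : ℤ) + i - j) - 1)) *
    (∏ j ∈ Finset.range (2 * k), (qq ^ ((2 * k : ℤ) - j) - 1))⁻¹


open WithZero in
lemma aux_v_qq (z : ℤ) : Valued.v (qq ^ z) = exp (-z : ℤ) := by
  have h := LaurentSeries.valuation_single_zpow ℚ z
  rw [RatFunc.single_zpow] at h
  exact h

lemma aux_v_one_sub (i : ℕ) : Valued.v (1 - qq ^ (i + 1) : LaurentSeries ℚ) = 1 := by
  apply Valuation.map_one_sub_of_lt
  have h := aux_v_qq ((i + 1 : ℕ) : ℤ)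
  rw [zpow_natCast] at h
  rw [h, ← WithZero.exp_zero, WithZero.exp_lt_exp]
  push_cast
  lia

lemma aux_v_qPoch (m : ℕ) : Valued.v (qPoch m) = 1 := by
  unfold qPoch
  rw [map_prod]
  exact Finset.prod_eq_one fun i _ => aux_v_one_sub i

lemma aux_qPoch_ne (m : ℕ) : qPoch m ≠ 0 := by
  intro h
  have := aux_v_qPoch m
  rw [h, map_zero] at this
  exact zero_ne_one this

lemma aux_qq_ne : qq ≠ 0 := by
  intro h
  have := aux_v_qq 1
  rw [zpow_one, h, map_zero] at this
  exact WithZero.exp_ne_zero this.symm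

lemma aux_qPoch_succ (m : ℕ) : qPoch (m + 1) = qPoch m * (1 - qq ^ (m + 1)) := by
  unfold qPoch
  rw [Finset.prod_range_succ]

lemma aux_one_sub_ne (m : ℕ) : (1 - qq ^ (m + 1) : LaurentSeries ℚ) ≠ 0 := by
  intro h
  have := aux_v_one_sub m
  rw [h, map_zero] at this
  exact zero_ne_one this

def auxU (x : LaurentSeries ℚ) (m : ℕ) : LaurentSeries ℚ :=
  (-1) ^ m * qq ^ (m.choose 2) * x ^ m * (qPoch m)⁻¹

def auxS (x : LaurentSeries ℚ) (n : ℕ) : LaurentSeries ℚ :=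
  ∑ p ∈ Finset.HasAntidiagonal.antidiagonal n, auxU x p.1 * (qPoch p.2)⁻¹

lemma aux_U_succ (x : LaurentSeries ℚ) (m : ℕ) :
    (1 - qq ^ (m + 1)) * auxU x (m + 1) = - x * qq ^ m * auxU x m := by
  unfold auxU
  rw [aux_qPoch_succ, Nat.choose_succ_succ' m 1, Nat.choose_one_right]
  have h1 := aux_one_sub_ne m
  have h2 := aux_qPoch_ne m
  field_simp
  ring

lemma aux_W_succ (m : ℕ) :
    (1 - qq ^ (m + 1)) * (qPoch (m + 1))⁻¹ = (qPoch m)⁻¹ := by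
  rw [aux_qPoch_succ]
  have h1 := aux_one_sub_ne m
  have h2 := aux_qPoch_ne m
  field_simp

lemma aux_S_succ (x : LaurentSeries ℚ) (n : ℕ) :
    (1 - qq ^ (n + 1)) * auxS x (n + 1) = (1 - x * qq ^ n) * auxS x n := by
  have e : (1 - qq ^ (n + 1)) * auxS x (n + 1) =
      ∑ p ∈ Finset.HasAntidiagonal.antidiagonal (n + 1), auxU x p.1 * ((1 - qq ^ p.2) * (qPoch p.2)⁻¹) +
      ∑ p ∈ Finset.HasAntidiagonal.antidiagonal (n + 1),
        qq ^ p.2 * ((1 - qq ^ p.1) * auxU x p.1) * (qPoch p.2)⁻¹ := by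
    unfold auxS
    rw [Finset.mul_sum, ← Finset.sum_add_distrib]
    refine Finset.sum_congr rfl fun p hp => ?_
    rw [Finset.HasAntidiagonal.mem_antidiagonal] at hp
    rw [← hp, pow_add]
    ring
  rw [e, Finset.Nat.sum_antidiagonal_succ', Finset.Nat.sum_antidiagonal_succ]
  simp only [aux_W_succ, aux_U_succ, pow_zero, sub_self, zero_mul, mul_zero, add_zero, zero_add]
  unfold auxS
  rw [Finset.mul_sum, ← Finset.sum_add_distrib]
  refine Finset.sum_congr rfl fun p hp => ?_
  rw [Finset.HasAntidiagonal.mem_antidiagonal] at hp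
  rw [← hp, pow_add]
  ring

lemma aux_S_zero (k n : ℕ) : auxS (qq ^ (-(k : ℤ))) (k + 1 + n) = 0 := by
  induction n with
  | zero =>
    have h := aux_S_succ (qq ^ (-(k : ℤ))) k
    rw [zpow_neg, zpow_natCast, inv_mul_cancel₀ (pow_ne_zero _ aux_qq_ne), sub_self,
      zero_mul] at h
    rw [zpow_neg, zpow_natCast]
    exact (mul_eq_zero.mp h).resolve_left (aux_one_sub_ne k)
  | succ n ih =>
    have h := aux_S_succ (qq ^ (-(k : ℤ))) (k + 1 + n)
    rw [ih, mul_zero] at h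
    exact (mul_eq_zero.mp h).resolve_left (aux_one_sub_ne _)

lemma aux_exp (k m : ℤ) (c : ℤ) (hc : 2 * c = m * (m - 1)) :
    (k + 1) * ((k + 1) + 1) / 2 + (m - (k + 1)) * (m - (k + 1) + 1) / 2
      = (k + 1) ^ 2 + c + -k * m := by
  have h1 : (k + 1) * ((k + 1) + 1) % 2 = 0 := by
    have := Int.even_mul_succ_self (k + 1)
    exact Int.even_iff.mp this
  have h2 : (m - (k + 1)) * (m - (k + 1) + 1) % 2 = 0 := by
    have := Int.even_mul_succ_self (m - (k + 1))
    exact Int.even_iff.mp this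
  have h3 : (k + 1) * ((k + 1) + 1) + (m - (k + 1)) * (m - (k + 1) + 1)
      = 2 * ((k + 1) ^ 2 + c + -k * m) := by linear_combination -hc
  omega

lemma aux_rho_eq (k m n : ℕ) (h : m + n = 2 * (k + 1)) :
    ρ (k + 1) ((m : ℤ) - (k + 1)) =
      -(qq ^ (((k : ℤ) + 1) ^ 2)) * (auxU (qq ^ (-(k : ℤ))) m * (qPoch n)⁻¹) := by
  unfold ρ
  have hc : ¬ (((k + 1 : ℕ) : ℤ) < |(m : ℤ) - (k + 1)|) := by
    rw [not_lt, abs_le]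
    push_cast
    omega
  rw [if_neg hc]
  have e1 : (((k + 1 : ℕ) : ℤ) + ((m : ℤ) - (k + 1))) = (m : ℤ) := by push_cast; ring
  have e2 : (((k + 1 : ℕ) : ℤ) - ((m : ℤ) - (k + 1))) = (n : ℤ) := by push_cast; omega
  rw [e1, e2, Int.toNat_natCast, Int.toNat_natCast]
  push_cast
  rw [aux_exp k m (m.choose 2), zpow_add₀ aux_qq_ne, zpow_add₀ aux_qq_ne, zpow_mul]
  · unfold auxU
    simp only [zpow_natCast, mul_inv]
    ring
  · have := Nat.triangle_succ (m - 1)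
    rw [Nat.choose_two_right]
    rcases m with _ | m
    · simp
    · have h2 : 2 ∣ (m + 1) * m := (Nat.even_mul_pred_self (m + 1)).two_dvd
      have := Nat.mul_div_cancel' h2
      simp only [Nat.add_sub_cancel]
      zify at this
      push_cast
      linarith

lemma aux_rho_out (k : ℕ) (j : ℤ) (h : (k : ℤ) < |j|) : ρ k j = 0 := by
  unfold ρ
  rw [if_pos h]

lemma aux_tsum_rho_succ (k : ℕ) : ∑' j : ℤ, ρ (k + 1) j = 0 := by
  have inj : Function.Injective (fun p : ℕ => (p : ℤ) - (k + 1)) := by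
    intro a b hab
    simp only at hab
    omega
  rw [tsum_eq_sum (s := (Finset.range (2 * (k + 1) + 1)).map ⟨_, inj⟩), Finset.sum_map]
  · have h0 := aux_S_zero k (k + 1)
    have e : k + 1 + (k + 1) = 2 * (k + 1) := by ring
    rw [e] at h0
    unfold auxS at h0
    rw [Finset.Nat.sum_antidiagonal_eq_sum_range_succ
      (fun i j => auxU (qq ^ (-(k : ℤ))) i * (qPoch j)⁻¹)] at h0
    rw [← mul_zero (-(qq ^ (((k : ℤ) + 1) ^ 2))), ← h0, Finset.mul_sum]
    refine Finset.sum_congr rfl fun m hm => ?_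
    rw [Finset.mem_range] at hm
    exact aux_rho_eq k m _ (by omega)
  · intro j hj
    apply aux_rho_out
    by_contra hlt
    apply hj
    rw [not_lt, abs_le] at hlt
    push_cast at hlt
    rw [Finset.mem_map]
    refine ⟨(j + (k + 1)).toNat, ?_, ?_⟩
    · rw [Finset.mem_range]
      omega
    · simp only [Function.Embedding.coeFn_mk]
      omega

lemma aux_tsum_rho_zero : ∑' j : ℤ, ρ 0 j = -1 := by
  rw [tsum_eq_single 0]
  · simp [ρ, qPoch]
  · intro j hj
    apply aux_rho_out
    simpa using hj

open WithZero in
lemma aux_v_rho (k : ℕ) (j : ℤ) :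
    Valued.v (ρ k j) ≤ exp (-((k : ℤ) * ((k : ℤ) + 1) / 2) : ℤ) := by
  unfold ρ
  split_ifs with hc
  · rw [map_zero]; exact zero_le
  · rw [Valuation.map_neg, map_mul, map_mul, map_inv₀, map_mul, aux_v_qPoch, aux_v_qPoch,
      aux_v_qq, map_zpow₀, Valuation.map_neg, map_one, one_zpow, mul_one, inv_one, one_mul,
      mul_one, exp_le_exp]
    have : 0 ≤ j * (j + 1) := by
      rcases le_or_gt 0 j with h | h
      · positivity
      · exact mul_nonneg_of_nonpos_of_nonpos (by omega) (by omega)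
    omega

open WithZero in
lemma aux_v_term (a : ℕ → LaurentSeries ℚ) (C : ℤ) (h : LBC a C) (k : ℕ) (j : ℤ) :
    Valued.v (a k * ρ k j) ≤ exp (-((k : ℤ) + 1 + C) : ℤ) := by
  have he : (k : ℤ) * (k + 1) % 2 = 0 := Int.even_iff.mp (Int.even_mul_succ_self (k : ℤ))
  have h1 : Valued.v (a k) ≤ exp (-(((k : ℤ) + 1 + C) - (k : ℤ) * ((k : ℤ) + 1) / 2) : ℤ) := by
    rw [LaurentSeries.valuation_le_iff_coeff_lt_eq_zero]
    intro n hn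
    apply h k n
    have : ((k : ℤ) + 1) * (k - 2) = k * (k + 1) - 2 * (k + 1) := by ring
    rw [this]
    omega
  rw [map_mul]
  refine (mul_le_mul' h1 (aux_v_rho k j)).trans ?_
  rw [← exp_add, exp_le_exp]
  omega

instance aux_nonarch : NonarchimedeanAddGroup (LaurentSeries ℚ) where
  is_nonarchimedean := by
    intro U hU
    rw [Valued.mem_nhds_zero] at hU
    obtain ⟨γ, hγ⟩ := hU
    exact ⟨⟨Valued.v.restrict.ltAddSubgroup γ, Valued.isOpen_ball _ _⟩, hγ⟩

open WithZero MonoidWithZeroHom.ValueGroup₀ in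
lemma aux_summable (a : ℕ → LaurentSeries ℚ) (C : ℤ) (h : LBC a C) :
    Summable (Function.uncurry fun (k : ℕ) (j : ℤ) => a k * ρ k j) := by
  apply NonarchimedeanAddGroup.summable_of_tendsto_cofinite_zero
  intro s hs
  rw [Valued.mem_nhds_zero] at hs
  obtain ⟨γ, hγ⟩ := hs
  have hD : exp (log (embedding γ.1) - 1) < embedding γ.1 := by
    rw [← lt_log_iff_exp_lt (by simp)]
    simp
  set D : ℤ := log (embedding γ.1) - 1 with hDdef
  rw [Filter.mem_map, Filter.mem_cofinite]
  refine (((Set.finite_Iio (-D - 1 - C).toNat).prod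
    (Set.finite_Icc (-((-D - 1 - C).toNat : ℤ)) (-D - 1 - C).toNat))).subset ?_
  rintro ⟨k, j⟩ hkj
  by_contra hcon
  apply hkj
  apply hγ
  change Valued.v.restrict (a k * ρ k j) < γ.1
  rw [Valuation.restrict_lt_iff_lt_embedding]
  by_cases hj : (k : ℤ) < |j|
  · rw [aux_rho_out k j hj, mul_zero, map_zero]
    exact lt_of_le_of_lt zero_le hD
  · refine ((aux_v_term a C h k j).trans ?_).trans_lt hD
    rw [exp_le_exp]
    by_contra hlt
    apply hcon
    rw [not_lt, abs_le] at hj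
    simp only [Set.mem_prod, Set.mem_Iio, Set.mem_Icc]
    omega

/-!
STATEMENT 12: Let (a_{−k−1})_{k≥0} be a sequence in ℚ((q)) satisfying the lower
bound condition.  Then the family of residue series (r_j)_{j∈ℤ} is summable in
ℚ((q)) and Σ_{j∈ℤ} r_j = −a_{−1} (where a_{−1} is the k = 0 term).
(Summability of each residue series r_j is included.)
-/

theorem residue_theorem_for_inverted_Habiro_series
    (a : ℕ → LaurentSeries ℚ) (C : ℤ) (h : LBC a C) :
    (∀ j : ℤ, Summable (fun k : ℕ => a k * ρ k j)) ∧
    Summable (fun j : ℤ => resid a j) ∧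
    ∑' j : ℤ, resid a j = -(a 0) := by
  have hs := aux_summable a C h
  have hs' : Summable (Function.uncurry fun (j : ℤ) (k : ℕ) => a k * ρ k j) := hs.prod_symm
  refine ⟨fun j => hs'.prod_factor j, hs'.prod, ?_⟩
  unfold resid
  rw [hs.tsum_comm, tsum_eq_single 0]
  · rw [tsum_mul_left, aux_tsum_rho_zero, mul_neg, mul_one]
  · intro k hk
    obtain ⟨k, rfl⟩ := Nat.exists_eq_succ_of_ne_zero hk
    rw [tsum_mul_left, Nat.succ_eq_add_one, aux_tsum_rho_succ, mul_zero]
end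
end

section
/- Let (a_{−k−1})_{k≥0} be a sequence in ℚ((q)) satisfying the lower bound condition, with residue series r_j, and set f_k = Σ_{k'=0}^{k} binom[k'+k, 2k']·a_{−k'−1} ∈ ℚ((q)). Then for every j ∈ ℤ, r_j = −q^{j(j+1)/2}·((q)_∞)⁻³ · Σ_{k=0}^{∞} f_k·(−1)^{k+j}·q^{k(k+1)/2}·(1 + Σ_{n=1}^{∞} (−1)ⁿ·q^{n(n+1)/2+n·k}·(q^{n·j} + q^{−n·j})), where all families appearing are summable in ℚ((q)) and (q)_∞ = ∏_{i≥1}(1−qⁱ) is an invertible element of ℚ[[q]] ⊂ ℚ((q)). -/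
noncomputable section

namespace GM
open WithZero Filter Topology

section abs
variable {K : Type*} [Field K] [hV : Valued K ℤᵐ⁰]

def Od (n : ℤ) (x : K) : Prop := Valued.v x ≤ (exp (-n) : ℤᵐ⁰)

lemma Od.mul {n m : ℤ} {x y : K} (hx : Od n x) (hy : Od m y) : Od (n + m) (x * y) := by
  unfold Od at *
  rw [map_mul, neg_add, exp_add]
  exact mul_le_mul' hx hy

lemma Od.mono {n m : ℤ} {x : K} (hx : Od n x) (h : m ≤ n) : Od m x := by
  unfold Od at *
  refine hx.trans ?_
  rw [exp_le_exp]; omega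

lemma Od.add {n : ℤ} {x y : K} (hx : Od n x) (hy : Od n y) : Od n (x + y) :=
  (Valued.v.map_add x y).trans (max_le hx hy)

lemma Od.neg {n : ℤ} {x : K} (hx : Od n x) : Od n (-x) := by
  unfold Od at *; rwa [Valuation.map_neg]

lemma Od.sub {n : ℤ} {x y : K} (hx : Od n x) (hy : Od n y) : Od n (x - y) := by
  rw [sub_eq_add_neg]; exact hx.add hy.neg

lemma Od.zero {n : ℤ} : Od n (0 : K) := by simp [Od]

lemma Od.one : Od 0 (1 : K) := by simp [Od]

lemma Od.sgn (n : ℤ) : Od 0 ((-1 : K) ^ n) := by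
  simp [Od, map_zpow₀, Valuation.map_neg]

lemma Od.sgn' (n : ℕ) : Od 0 ((-1 : K) ^ n) := by
  simp [Od, map_pow, Valuation.map_neg]

lemma Od.qp {q : K} (hq : Valued.v q = (exp (-1) : ℤᵐ⁰)) (n : ℤ) : Od n (q ^ n) := by
  unfold Od
  rw [map_zpow₀, hq, ← exp_zsmul]; simp

lemma isClosed_Od {q : K} (hq : Valued.v q = (exp (-1) : ℤᵐ⁰)) (n : ℤ) :
    IsClosed {x : K | Od n x} := by
  have h1 : Valued.v (q ^ n) = (exp (-n) : ℤᵐ⁰) := by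
    rw [map_zpow₀, hq, ← exp_zsmul]; simp
  have h2 : {x : K | Od n x} = {x : K | Valued.v.restrict x ≤ Valued.v.restrict (q ^ n)} := by
    ext x
    simp only [Set.mem_ofPred_eq, Od, Valuation.restrict_le_iff, h1]
  rw [h2]
  exact Valued.isClosed_closedBall K _

instance nonarchK : NonarchimedeanAddGroup K where
  is_nonarchimedean := by
    intro U hU
    obtain ⟨γ, hγ⟩ := Valued.mem_nhds_zero.1 hU
    exact ⟨⟨Valuation.ltAddSubgroup Valued.v.restrict γ, Valued.isOpen_ball K γ.1⟩, hγ⟩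

lemma Od.hasSum {ι : Type*} {n : ℤ} {f : ι → K} {s : K}
    {q : K} (hq : Valued.v q = (exp (-1) : ℤᵐ⁰)) (h : ∀ i, Od n (f i)) (hs : HasSum f s) :
    Od n s := by
  refine (isClosed_Od hq n).mem_of_tendsto hs (Eventually.of_forall fun t => ?_)
  show Od n _
  induction t using Finset.cons_induction with
  | empty => simpa using Od.zero
  | cons a t ha ih => rw [Finset.sum_cons]; exact (h a).add ih

lemma Od.tsum {ι : Type*} {n : ℤ} {f : ι → K}
    {q : K} (hq : Valued.v q = (exp (-1) : ℤᵐ⁰)) (h : ∀ i, Od n (f i)) :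
    Od n (∑' i, f i) := by
  by_cases hs : Summable f
  · exact Od.hasSum hq h hs.hasSum
  · rw [tsum_eq_zero_of_not_summable hs]; exact Od.zero

lemma mem_nhds_Od {a : K} {s : Set K} (hs : s ∈ 𝓝 a) : ∃ n : ℕ, ∀ x, Od n (x - a) → x ∈ s := by
  rw [Valued.mem_nhds] at hs
  obtain ⟨γ, hγ⟩ := hs
  set g : ℤᵐ⁰ := MonoidWithZeroHom.ValueGroup₀.embedding γ.1 with hg
  have hg0 : g ≠ 0 := by simp [hg]
  refine ⟨(1 - log g).toNat, fun x hx => hγ ?_⟩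
  rw [Set.mem_ofPred_eq, Valuation.restrict_lt_iff_lt_embedding]
  refine lt_of_le_of_lt hx ?_
  rw [← lt_log_iff_exp_lt hg0]
  omega

lemma Od.eq_zero {x : K} (h : ∀ n : ℕ, Od n x) : x = 0 := by
  by_contra hx
  have := mem_nhds_Od (isOpen_compl_singleton.mem_nhds (x := (0:K)) (show (0:K) ∈ ({x}ᶜ : Set K) by simpa using fun h => hx h.symm))
  obtain ⟨n, hn⟩ := this
  have := hn x (by simpa using h n)
  simp at this

lemma summable_of_Od [CompleteSpace K] {ι : Type*} {f : ι → K} (g : ι → ℤ)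
    (h : ∀ i, Od (g i) (f i)) (hg : ∀ N : ℕ, {i | g i < N}.Finite) : Summable f := by
  apply NonarchimedeanAddGroup.summable_of_tendsto_cofinite_zero
  intro s hs
  obtain ⟨n, hn⟩ := mem_nhds_Od hs
  rw [mem_map, mem_cofinite]
  refine (hg n).subset fun i hi => ?_
  by_contra hc
  simp only [Set.mem_ofPred_eq, not_lt] at hc
  exact hi (hn _ (by simpa using (h i).mono hc))

set_option linter.unusedSectionVars false

lemma summable_lin [CompleteSpace K] {ι : Type*} {f : ι → K} (g : ι → ℤ) (sz : ι → ℕ)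
    (hsz : ∀ N : ℕ, {i | sz i ≤ N}.Finite) (D : ℤ)
    (h : ∀ i, Od (g i) (f i)) (hg : ∀ i, (sz i : ℤ) ≤ 2 * g i + D) : Summable f := by
  refine summable_of_Od g h fun N => (hsz (2 * N + D).toNat).subset fun i hi => ?_
  have := hg i
  simp only [Set.mem_ofPred_eq] at hi ⊢
  omega

lemma sz_nat (N : ℕ) : {i : ℕ | i ≤ N}.Finite := Set.finite_Iic N

lemma sz_nat2 (N : ℕ) : {p : ℕ × ℕ | p.1 + p.2 ≤ N}.Finite := by
  refine ((Set.finite_Iic N).prod (Set.finite_Iic N)).subset fun p hp => ?_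
  simp only [Set.mem_ofPred_eq, Set.mem_prod, Set.mem_Iic] at hp ⊢
  omega

lemma sz_int (N : ℕ) : {p : ℤ | p.natAbs ≤ N}.Finite := by
  refine ((Set.finite_Icc (-N : ℤ) N)).subset fun p hp => ?_
  simp only [Set.mem_ofPred_eq, Set.mem_Icc] at hp ⊢
  omega

lemma sz_int_nat (N : ℕ) : {p : ℤ × ℕ | p.1.natAbs + p.2 ≤ N}.Finite := by
  refine ((Set.finite_Icc (-N : ℤ) N).prod (Set.finite_Iic N)).subset fun p hp => ?_
  simp only [Set.mem_ofPred_eq, Set.mem_prod, Set.mem_Iic, Set.mem_Icc] at hp ⊢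
  omega

def tri (n : ℤ) : ℤ := n * (n + 1) / 2

lemma two_tri (n : ℤ) : 2 * tri n = n * (n + 1) :=
  Int.mul_ediv_cancel' (Int.even_mul_succ_self n).two_dvd

lemma tri_add (a b : ℤ) : tri (a + b) = tri a + tri b + a * b := by
  have h1 := two_tri (a + b)
  have h2 := two_tri a
  have h3 := two_tri b
  linarith

lemma tri_succ (a : ℤ) : tri (a + 1) = tri a + a + 1 := by
  have h1 := two_tri (a + 1)
  have h2 := two_tri a
  linarith

lemma tri_zero : tri 0 = 0 := rfl

lemma le_tri (n : ℤ) : n ≤ tri n := by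
  have := two_tri n
  have : 0 ≤ n * (n - 1) := by
    rcases le_or_gt n 0 with h | h
    · nlinarith
    · exact mul_nonneg h.le (by omega)
  linarith

def P (q : K) (m : ℕ) : K := ∏ i ∈ Finset.range m, (1 - q ^ (i + 1))

def u (q : K) (n : ℤ) : K := if 0 ≤ n then (P q n.toNat)⁻¹ else 0

variable {q : K} (hq : Valued.v q = (exp (-1) : ℤᵐ⁰))

include hq

lemma q_ne : q ≠ 0 := by
  rintro rfl
  rw [map_zero] at hq
  exact exp_ne_zero hq.symm

lemma v_one_sub (n : ℕ) : Valued.v (1 - q ^ (n + 1)) = (1 : ℤᵐ⁰) := by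
  apply Valuation.map_one_sub_of_lt
  rw [map_pow, hq, ← exp_nsmul, ← exp_zero, exp_lt_exp]
  simp; omega

lemma v_P (n : ℕ) : Valued.v (P q n) = (1 : ℤᵐ⁰) := by
  unfold P
  rw [map_prod]
  exact Finset.prod_eq_one fun i _ => v_one_sub hq i

lemma P_ne (n : ℕ) : P q n ≠ 0 := by
  intro h
  have := v_P hq n
  rw [h] at this
  simp at this

lemma P_succ (n : ℕ) : P q (n + 1) = P q n * (1 - q ^ (n + 1)) := Finset.prod_range_succ _ _

lemma one_sub_ne (n : ℕ) : 1 - q ^ (n + 1) ≠ 0 := by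
  have := P_ne hq (n + 1)
  rw [P_succ hq] at this
  exact right_ne_zero_of_mul this

omit hq in
lemma u_nat (n : ℕ) : u q n = (P q n)⁻¹ := by simp [u]

omit hq in
lemma u_neg {n : ℤ} (h : n < 0) : u q n = 0 := by simp [u, h]

omit hq in
lemma u_zero : u q 0 = 1 := by simp [u, P]

lemma P_u (n : ℕ) : P q n * u q n = 1 := by
  rw [u_nat]; exact mul_inv_cancel₀ (P_ne hq n)

lemma Od_u (n : ℤ) : Od 0 (u q n) := by
  unfold u
  split_ifs
  · simp [Od, v_P hq]
  · exact Od.zero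

lemma Od_P (n : ℕ) : Od 0 (P q n) := by
  simp [Od, v_P hq]

lemma u_rec (n : ℤ) : (1 - q ^ n) * u q n = u q (n - 1) := by
  rcases lt_trichotomy n 0 with h | rfl | h
  · rw [u_neg h, u_neg (by omega)]; simp
  · rw [u_neg (n := 0 - 1) (by omega)]; simp
  · obtain ⟨k, rfl⟩ : ∃ k : ℕ, n = ((k + 1 : ℕ) : ℤ) := ⟨n.toNat - 1, by omega⟩
    rw [u_nat, show (((k + 1 : ℕ) : ℤ) - 1) = (k : ℤ) by push_cast; ring, u_nat, P_succ hq,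
      zpow_natCast]
    have := P_ne hq k
    have := one_sub_ne hq k
    field_simp

def t1 (q : K) (c : ℤ) (l : ℕ) : K := (-1) ^ l * q ^ (tri l + c * l) * u q l

def E1 (q : K) (c : ℤ) : K := ∑' l : ℕ, t1 q c l

lemma Od_t1 (c : ℤ) (l : ℕ) : Od (tri l + c * l) (t1 q c l) := by
  have := ((Od.sgn' (K := K) l).mul (Od.qp hq (tri l + c * l))).mul (Od_u hq l)
  rw [zero_add, add_zero] at this
  exact this

lemma summable_t1 [CompleteSpace K] (c : ℤ) : Summable (t1 q c) := by
  refine summable_lin _ id sz_nat (c ^ 2) (Od_t1 hq c) fun l => ?_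
  have := two_tri l
  simp only [id]
  nlinarith [sq_nonneg ((l : ℤ) + c)]

lemma E1_rec [CompleteSpace K] (c : ℤ) : E1 q (c - 1) = (1 - q ^ c) * E1 q c := by
  have h : E1 q (c - 1) - E1 q c = - q ^ c * E1 q c := by
    unfold E1
    rw [← (summable_t1 hq (c - 1)).tsum_sub (summable_t1 hq c),
      ((summable_t1 hq (c - 1)).sub (summable_t1 hq c)).tsum_eq_zero_add, ← tsum_mul_left]
    simp only [t1]
    rw [show ∀ a b : K, a = 0 → a + b = b from fun a b h => by rw [h, zero_add]]
    · apply tsum_congr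
      intro l
      have h1 := u_rec hq ((l : ℤ) + 1)
      rw [show (l : ℤ) + 1 - 1 = l by ring] at h1
      rw [← h1]
      push_cast
      rw [tri_succ, show tri (l : ℤ) + l + 1 + (c - 1) * (l + 1) = (tri l + c * l) + c by ring,
        show tri (l : ℤ) + l + 1 + c * (l + 1) = (tri l + c * l) + c + (l + 1) by ring]
      rw [zpow_add₀ (q_ne hq) _ ((l : ℤ) + 1), zpow_add₀ (q_ne hq) _ c]
      ring
    · simp [tri_zero, u_zero]
  linear_combination h

lemma E1_sub_one [CompleteSpace K] (c : ℕ) : Od (c + 1) (E1 q c - 1) := by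
  unfold E1
  rw [(summable_t1 hq c).tsum_eq_zero_add]
  have : t1 q c 0 = 1 := by simp [t1, tri_zero, u_zero]
  rw [this, add_sub_cancel_left]
  refine Od.tsum hq fun l => (Od_t1 hq c (l + 1)).mono ?_
  have := le_tri ((l + 1 : ℕ) : ℤ)
  have h2 : (0 : ℤ) ≤ c * l := by positivity
  push_cast at *
  nlinarith

lemma E1_eq [CompleteSpace K] (c : ℤ) : E1 q c = E1 q 0 * u q c := by
  rcases le_or_gt 0 c with h | h
  · obtain ⟨n, rfl⟩ := Int.eq_ofNat_of_zero_le h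
    clear h
    induction n with
    | zero => simp [u_zero]
    | succ n ih =>
      have h1 := E1_rec hq ((n + 1 : ℕ) : ℤ)
      have h2 := u_rec hq ((n + 1 : ℕ) : ℤ)
      rw [show (((n + 1 : ℕ) : ℤ) - 1) = (n : ℤ) by push_cast; ring] at h1 h2
      have h3 : (1 - q ^ ((n + 1 : ℕ) : ℤ)) ≠ 0 := by
        rw [zpow_natCast]; exact one_sub_ne hq n
      apply mul_left_cancel₀ h3
      rw [← h1, ih, ← h2]; ring
  · rw [u_neg h, mul_zero]
    obtain ⟨n, rfl⟩ : ∃ n : ℕ, c = -(n : ℤ) - 1 := ⟨(-c - 1).toNat, by omega⟩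
    clear h
    induction n with
    | zero => rw [E1_rec hq]; simp
    | succ n ih =>
      rw [E1_rec hq, show -((n + 1 : ℕ) : ℤ) = -(n : ℤ) - 1 by push_cast; ring, ih, mul_zero]

lemma E1_ne [CompleteSpace K] : E1 q 0 ≠ 0 := by
  intro h
  have := E1_sub_one hq 0
  simp only [Nat.cast_zero, h, Od, zero_sub, Valuation.map_neg, map_one] at this
  rw [← exp_zero, exp_le_exp] at this
  omega

lemma hasProd_E1 [CompleteSpace K] : HasProd (fun i : ℕ => 1 - q ^ (i + 1)) (E1 q 0) := by
  intro s hs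
  obtain ⟨n, hn⟩ := mem_nhds_Od hs
  rw [mem_map]
  simp only [SummationFilter.unconditional_filter]
  refine Filter.mem_of_superset (Filter.mem_atTop (Finset.range n)) fun t ht => hn _ ?_
  have ht' : Finset.range n ⊆ t := ht
  show Od (n : ℤ) (∏ x ∈ t, (1 - q ^ (x + 1)) - E1 q 0)
  rw [← Finset.prod_sdiff ht', mul_comm]
  have h1 : E1 q 0 = P q n * E1 q n := by
    rw [E1_eq hq n]
    linear_combination (- E1 q 0) * P_u hq n
  have h2 : ∀ r : Finset ℕ, (∀ i ∈ r, n ≤ i) → Od n (∏ i ∈ r, (1 - q ^ (i + 1)) - 1) := by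
    intro r
    induction r using Finset.cons_induction with
    | empty => intro _; simpa using Od.zero
    | cons a r ha ih =>
      intro h
      rw [Finset.prod_cons]
      have h3 := ih fun i hi => h i (Finset.mem_cons_of_mem hi)
      have h4 : n ≤ a := h a (Finset.mem_cons_self a r)
      have h5 : Od n (q ^ (a + 1)) := by
        have := Od.qp hq ((a + 1 : ℕ) : ℤ)
        rw [zpow_natCast] at this
        exact this.mono (by push_cast; omega)
      have h6 : Od 0 (1 - q ^ (a + 1)) := by simp [Od, v_one_sub hq]
      have := (h6.mul h3).sub (by simpa using h5)
      convert this using 1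
      · omega
      · ring
  have h3 := h2 (t \ Finset.range n) (by intro i hi; simp at hi; omega)
  have h4 := h3.sub ((E1_sub_one hq n).mono (by omega))
  have h5 := (Od_P hq n).mul h4
  rw [zero_add] at h5
  convert h5 using 1
  rw [h1]
  simp only [P]
  ring

def t2 (q : K) (c : ℕ) (r : ℕ) : K := q ^ (((c : ℤ) + 1) * r) * u q r

def E2 (q : K) (c : ℕ) : K := ∑' r : ℕ, t2 q c r

lemma Od_t2 (c : ℕ) (r : ℕ) : Od (((c : ℤ) + 1) * r) (t2 q c r) := by
  have := ((Od.qp hq (((c : ℤ) + 1) * r))).mul (Od_u hq r)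
  rw [add_zero] at this
  exact this

lemma summable_t2 [CompleteSpace K] (c : ℕ) : Summable (t2 q c) := by
  refine summable_lin _ id sz_nat 0 (Od_t2 hq c) fun l => ?_
  simp only [id]
  have : (0 : ℤ) ≤ c * l := by positivity
  nlinarith

lemma E2_rec [CompleteSpace K] (c : ℕ) : E2 q (c + 1) = (1 - q ^ (c + 1)) * E2 q c := by
  have h : E2 q c - E2 q (c + 1) = q ^ (c + 1) * E2 q c := by
    unfold E2
    rw [← (summable_t2 hq c).tsum_sub (summable_t2 hq (c + 1)),
      ((summable_t2 hq c).sub (summable_t2 hq (c + 1))).tsum_eq_zero_add, ← tsum_mul_left]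
    simp only [t2]
    rw [show ∀ a b : K, a = 0 → a + b = b from fun a b h => by rw [h, zero_add]]
    · apply tsum_congr
      intro l
      have h1 := u_rec hq ((l : ℤ) + 1)
      rw [show (l : ℤ) + 1 - 1 = l by ring] at h1
      rw [← h1, ← zpow_natCast q (c + 1)]
      push_cast
      rw [show ((c : ℤ) + 1) * (l + 1) = ((c : ℤ) + 1) * l + (c + 1) by ring,
        show ((c : ℤ) + 1 + 1) * (l + 1) = ((c : ℤ) + 1) * l + (c + 1) + (l + 1) by ring]
      rw [zpow_add₀ (q_ne hq) _ ((l : ℤ) + 1), zpow_add₀ (q_ne hq) _ ((c : ℤ) + 1)]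
      ring
    · simp [u_zero]
  linear_combination -h

lemma E2_sub_one [CompleteSpace K] (c : ℕ) : Od (c + 1) (E2 q c - 1) := by
  unfold E2
  rw [(summable_t2 hq c).tsum_eq_zero_add]
  have : t2 q c 0 = 1 := by simp [t2, u_zero]
  rw [this, add_sub_cancel_left]
  refine Od.tsum hq fun l => (Od_t2 hq c (l + 1)).mono ?_
  have h2 : (0 : ℤ) ≤ c * l := by positivity
  push_cast at *
  nlinarith

lemma E2_eq0 [CompleteSpace K] (c : ℕ) : E2 q c = P q c * E2 q 0 := by
  induction c with
  | zero => simp [P]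
  | succ n ih => rw [E2_rec hq, ih, P_succ hq]; ring

lemma E1_E2 [CompleteSpace K] : E1 q 0 * E2 q 0 = 1 := by
  rw [← sub_eq_zero]
  apply Od.eq_zero
  intro n
  have h1 := E1_sub_one hq n
  have h2 := E2_sub_one hq n
  have h3 : E1 q 0 * E2 q 0 = E1 q n * E2 q n := by
    rw [E1_eq hq n, E2_eq0 hq n]
    linear_combination (- E1 q 0 * E2 q 0) * P_u hq n
  have h4 := ((h1.mul h2).mono (m := n) (by omega)).add
    ((h1.mono (m := n) (by omega)).add (h2.mono (m := n) (by omega)))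
  rw [h3]
  convert h4 using 1
  ring

lemma E2_eq [CompleteSpace K] (c : ℕ) : E2 q c = P q c * (E1 q 0)⁻¹ := by
  rw [E2_eq0 hq]
  have := E1_E2 hq
  have h := E1_ne hq
  field_simp
  linear_combination P q c * this

def T (q : K) (M c : ℤ) : K := ∑' r : ℕ, t1 q c r * u q (M - r)

lemma summable_T [CompleteSpace K] (M c : ℤ) : Summable (fun r : ℕ => t1 q c r * u q (M - r)) := by
  refine summable_lin _ id sz_nat (c ^ 2) (fun r => (Od_t1 hq c r).mul (Od_u hq _)) fun l => ?_
  have := two_tri l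
  simp only [id]
  nlinarith [sq_nonneg ((l : ℤ) + c)]

lemma T_rec [CompleteSpace K] (M c : ℤ) :
    (1 - q ^ M) * T q M c = (1 - q ^ (M + c)) * T q (M - 1) c := by
  have h : (1 - q ^ M) * T q M c - T q (M - 1) c = - q ^ (M + c) * T q (M - 1) c := by
    unfold T
    rw [← tsum_mul_left, ← ((summable_T hq M c).mul_left _).tsum_sub (summable_T hq (M - 1) c),
      (((summable_T hq M c).mul_left _).sub (summable_T hq (M - 1) c)).tsum_eq_zero_add,
      ← tsum_mul_left]
    rw [show ∀ a b : K, a = 0 → a + b = b from fun a b h => by rw [h, zero_add]]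
    · apply tsum_congr
      intro l
      have h1 := u_rec hq ((l : ℤ) + 1)
      have h2 := u_rec hq (M - ((l : ℤ) + 1))
      rw [show (l : ℤ) + 1 - 1 = l by ring] at h1
      push_cast
      rw [show M - 1 - ((l : ℤ) + 1) = M - ((l : ℤ) + 1) - 1 by ring, ← h2,
        show M - 1 - (l : ℤ) = M - ((l : ℤ) + 1) by ring]
      simp only [t1]
      rw [← h1]
      push_cast
      have e : M = (M - ((l : ℤ) + 1)) + ((l : ℤ) + 1) := by ring
      rw [tri_succ, show tri (l : ℤ) + l + 1 + c * (l + 1) = (tri l + c * l) + c + (l + 1) by ring]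
      rw [zpow_add₀ (q_ne hq) _ ((l : ℤ) + 1), zpow_add₀ (q_ne hq) _ c, zpow_add₀ (q_ne hq) M c]
      have e2 : q ^ M = q ^ (M - ((l : ℤ) + 1)) * q ^ ((l : ℤ) + 1) := by
        rw [← zpow_add₀ (q_ne hq), ← e]
      rw [e2]
      ring
    · have h2 := u_rec hq M
      simp only [Nat.cast_zero, sub_zero]
      rw [← h2]; ring
  linear_combination h

lemma T_neg {M : ℤ} (c : ℤ) (h : M < 0) : T q M c = 0 := by
  unfold T
  rw [← tsum_zero (α := K) (β := ℕ)]
  refine tsum_congr fun r => ?_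
  rw [u_neg (by omega), mul_zero]

lemma T_zero (c : ℤ) : T q 0 c = 1 := by
  unfold T
  rw [tsum_eq_single 0]
  · simp [t1, tri_zero, u_zero]
  · intro r hr
    rw [u_neg (by omega), mul_zero]

lemma T_prod [CompleteSpace K] (M : ℕ) (c : ℤ) :
    T q M c = u q M * ∏ i ∈ Finset.range M, (1 - q ^ (c + 1 + i)) := by
  induction M with
  | zero => simp [T_zero hq, u_zero]
  | succ n ih =>
    have h1 := T_rec hq ((n + 1 : ℕ) : ℤ) c
    have h2 := u_rec hq ((n + 1 : ℕ) : ℤ)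
    rw [show (((n + 1 : ℕ) : ℤ) - 1) = (n : ℤ) by push_cast; ring] at h1 h2
    have h3 : (1 - q ^ ((n + 1 : ℕ) : ℤ)) ≠ 0 := by
      rw [zpow_natCast]; exact one_sub_ne hq n
    apply mul_left_cancel₀ h3
    rw [h1, ih, ← h2, Finset.prod_range_succ,
      show c + 1 + (n : ℤ) = ((n + 1 : ℕ) : ℤ) + c by push_cast; ring]
    ring

lemma P_prod (c M : ℕ) :
    ∏ i ∈ Finset.range M, (1 - q ^ ((c : ℤ) + 1 + i)) = u q c * P q (c + M) := by
  have h1 : P q (c + M) = P q c * ∏ i ∈ Finset.range M, (1 - q ^ ((c : ℤ) + 1 + i)) := by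
    unfold P
    rw [Finset.prod_range_add]
    congr 1
    refine Finset.prod_congr rfl fun i _ => ?_
    rw [← zpow_natCast]
    congr 2
    push_cast; ring
  rw [h1, ← mul_assoc, mul_comm (u q c), P_u hq, one_mul]

lemma T_final [CompleteSpace K] (m : ℕ) (j : ℤ) :
    T q (m + j) (m - j) = u q (m + j) * u q (m - j) * P q (2 * m) := by
  rcases lt_or_ge ((m : ℤ) + j) 0 with h | h
  · rw [T_neg hq _ h, u_neg h]; ring
  obtain ⟨M, hM⟩ := Int.eq_ofNat_of_zero_le h
  rw [hM, T_prod hq, mul_assoc]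
  congr 1
  rcases lt_or_ge ((m : ℤ) - j) 0 with h' | h'
  · rw [u_neg h', zero_mul]
    apply Finset.prod_eq_zero (i := (-((m : ℤ) - j + 1)).toNat)
    · simp; omega
    · have : (m : ℤ) - j + 1 + ((-((m : ℤ) - j + 1)).toNat : ℤ) = 0 := by omega
      rw [this]; simp
  · obtain ⟨c, hc⟩ := Int.eq_ofNat_of_zero_le h'
    rw [hc, P_prod hq]
    congr 2
    omega

/-- the double family -/
def F (q : K) (m : ℕ) (j : ℤ) (p : ℕ × ℕ) : K :=
  t1 q (m - j) p.1 * t1 q (m + j - p.1) p.2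

lemma summable_F [CompleteSpace K] (m : ℕ) (j : ℤ) : Summable (F q m j) := by
  refine summable_lin _ (fun p => p.1 + p.2) sz_nat2 (j ^ 2)
    (fun p => (Od_t1 hq _ p.1).mul (Od_t1 hq _ p.2)) fun p => ?_
  have h1 := two_tri p.1
  have h2 := two_tri p.2
  push_cast
  have : (0 : ℤ) ≤ m * p.1 := by positivity
  have : (0 : ℤ) ≤ m * p.2 := by positivity
  nlinarith [sq_nonneg ((p.2 : ℤ) - p.1 + j)]

lemma tsum_F [CompleteSpace K] (m : ℕ) (j : ℤ) :
    ∑' p, F q m j p = E1 q 0 * T q (m + j) (m - j) := by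
  rw [(summable_F hq m j).tsum_prod]
  unfold T
  rw [← tsum_mul_left]
  refine tsum_congr fun r => ?_
  simp only [F]
  rw [tsum_mul_left]
  change t1 q (m - j) r * E1 q (m + j - r) = _
  rw [E1_eq hq]; ring

def diag : ℤ × ℕ ≃ ℕ × ℕ where
  toFun p := (p.2 + (-p.1).toNat, p.2 + p.1.toNat)
  invFun p := ((p.2 : ℤ) - p.1, min p.1 p.2)
  left_inv p := by
    ext
    · simp
    · simp; omega
  right_inv p := by
    ext
    · simp; omega
    · simp; omega

def g (q : K) (k : ℕ) (j n : ℤ) : K :=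
  (-1) ^ n.natAbs * q ^ (tri n.natAbs + n.natAbs * k + n * j)

lemma F_diag (m : ℕ) (j : ℤ) (n : ℤ) (r : ℕ) :
    F q m j (diag (n, r)) = g q m j n *
      (q ^ ((((2 * m : ℕ) : ℤ) + 1) * r) * u q r * u q (n.natAbs + r)) := by
  have hs : ∀ a b : ℕ, (-1 : K) ^ a * (-1) ^ (a + b) = (-1) ^ b := by
    intro a b
    rw [pow_add, ← mul_assoc, ← pow_add, Even.neg_one_pow ⟨a, rfl⟩, one_mul]
  simp only [F, diag, Equiv.coe_fn_mk, g, t1]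
  rcases le_total 0 n with h | h
  · obtain ⟨N, rfl⟩ := Int.eq_ofNat_of_zero_le h
    simp only [Int.toNat_neg_natCast, add_zero, Int.toNat_natCast, Int.natAbs_natCast]
    have e : q ^ (tri (r : ℤ) + (m - j) * r) * q ^ (tri ((r + N : ℕ) : ℤ) + (m + j - r) * (r + N : ℕ))
        = q ^ (tri (N : ℤ) + N * m + N * j) * q ^ ((((2 * m : ℕ) : ℤ) + 1) * r) := by
      rw [← zpow_add₀ (q_ne hq), ← zpow_add₀ (q_ne hq)]
      congr 1
      push_cast
      rw [tri_add]
      have := two_tri r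
      linear_combination this
    rw [← hs r N, show ((r + N : ℕ) : ℤ) = N + r by push_cast; ring] at *
    linear_combination (-1) ^ r * (-1) ^ (r + N) * u q r * u q (N + r) * e
  · obtain ⟨N, hN⟩ := Int.eq_ofNat_of_zero_le (neg_nonneg.2 h)
    obtain rfl : n = -(N : ℤ) := by omega
    simp only [Int.toNat_neg_natCast, add_zero, Int.toNat_natCast, Int.natAbs_natCast, neg_neg,
      Int.natAbs_neg]
    have e : q ^ (tri ((r + N : ℕ) : ℤ) + (m - j) * (r + N : ℕ)) *
          q ^ (tri (r : ℤ) + (m + j - (r + N : ℕ)) * r)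
        = q ^ (tri (N : ℤ) + N * m + -N * j) * q ^ ((((2 * m : ℕ) : ℤ) + 1) * r) := by
      rw [← zpow_add₀ (q_ne hq), ← zpow_add₀ (q_ne hq)]
      congr 1
      push_cast
      rw [tri_add]
      have := two_tri r
      linear_combination this
    rw [← hs r N, show ((r + N : ℕ) : ℤ) = N + r by push_cast; ring] at *
    linear_combination (-1) ^ r * (-1) ^ (r + N) * u q r * u q (N + r) * e

lemma S_eq [CompleteSpace K] (m N : ℕ) :
    E1 q 0 ^ 2 * ∑' r : ℕ, (q ^ ((((2 * m : ℕ) : ℤ) + 1) * r) * u q r * u q (N + r))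
      = ∑' l : ℕ, t1 q N l * P q (2 * m + l) := by
  have hs : Summable (Function.uncurry fun r l : ℕ => t2 q (2 * m) r * t1 q (N + r) l) := by
    refine summable_lin _ (fun p => p.1 + p.2) sz_nat2 0
      (fun p => (Od_t2 hq _ p.1).mul (Od_t1 hq _ p.2)) fun p => ?_
    have h2 := two_tri p.2
    push_cast
    have : (0 : ℤ) ≤ m * p.1 := by positivity
    have : (0 : ℤ) ≤ N * p.2 := by positivity
    have : (0 : ℤ) ≤ (p.1 : ℤ) * p.2 := by positivity
    nlinarith
  have h1 := hs.tsum_comm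
  have h2 : ∀ r : ℕ, ∑' l : ℕ, t2 q (2 * m) r * t1 q (N + r) l
      = E1 q 0 * (q ^ ((((2 * m : ℕ) : ℤ) + 1) * r) * u q r * u q (N + r)) := by
    intro r
    rw [tsum_mul_left]
    change _ * E1 q _ = _
    rw [E1_eq hq, t2]; ring
  have h3 : ∀ l : ℕ, ∑' r : ℕ, t2 q (2 * m) r * t1 q (N + r) l
      = (E1 q 0)⁻¹ * (t1 q N l * P q (2 * m + l)) := by
    intro l
    have : ∀ r : ℕ, t2 q (2 * m) r * t1 q (N + r) l = t1 q N l * t2 q (2 * m + l) r := by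
      intro r
      simp only [t1, t2]
      have e : q ^ ((((2 * m : ℕ) : ℤ) + 1) * r) * q ^ (tri (l : ℤ) + (N + r) * l) =
        q ^ (tri (l : ℤ) + N * l) * q ^ ((((2 * m + l : ℕ) : ℤ) + 1) * r) := by
        rw [← zpow_add₀ (q_ne hq), ← zpow_add₀ (q_ne hq)]
        congr 1
        push_cast; ring
      linear_combination (-1) ^ l * u q r * u q l * e
    simp_rw [this]
    rw [tsum_mul_left]
    change _ * E2 q _ = _
    rw [E2_eq hq]; ring
  simp_rw [h2, h3] at h1
  rw [tsum_mul_left, tsum_mul_left] at h1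
  have := E1_ne hq
  field_simp at h1
  exact h1.symm

def G (q : K) (k : ℕ) (j : ℤ) : K := ∑' n : ℤ, g q k j n

lemma Od_g (k : ℕ) (j n : ℤ) : Od (tri n.natAbs + n.natAbs * k + n * j) (g q k j n) := by
  have := ((Od.sgn' (K := K) n.natAbs)).mul (Od.qp hq (tri n.natAbs + n.natAbs * k + n * j))
  rw [zero_add] at this
  exact this

lemma bound_g (k : ℕ) (j n : ℤ) :
    (n.natAbs : ℤ) ≤ 2 * (tri n.natAbs + n.natAbs * k + n * j) + j ^ 2 := by
  have h2 := two_tri n.natAbs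
  have h3 : (n.natAbs : ℤ) * n.natAbs = n * n := Int.natAbs_mul_self
  have : (0 : ℤ) ≤ n.natAbs * k := by positivity
  nlinarith [sq_nonneg (n + j)]

lemma summable_g [CompleteSpace K] (k : ℕ) (j : ℤ) : Summable (g q k j) :=
  summable_lin _ Int.natAbs sz_int (j ^ 2) (Od_g hq k j) (bound_g hq k j)

lemma Od_G (k : ℕ) (j : ℤ) : Od (-(j ^ 2)) (G q k j) := by
  refine Od.tsum hq fun n => (Od_g hq k j n).mono ?_
  have := bound_g hq k j n
  have := sq_nonneg j
  omega

lemma keyA [CompleteSpace K] (m : ℕ) (j : ℤ) :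
    E1 q 0 ^ 3 * (u q (m + j) * u q (m - j) * P q (2 * m)) =
      ∑' l : ℕ, (-1) ^ l * q ^ tri l * u q l * P q (2 * m + l) * G q (m + l) j := by
  have h0 : Summable fun p => F q m j (diag p) := (diag.summable_iff (f := F q m j)).2 (summable_F hq m j)
  have h1 : E1 q 0 ^ 3 * (u q (m + j) * u q (m - j) * P q (2 * m)) =
      E1 q 0 ^ 2 * ∑' p, F q m j (diag p) := by
    rw [diag.tsum_eq (F q m j), tsum_F hq, T_final hq]; ring
  rw [h1, h0.tsum_prod, ← tsum_mul_left]
  have h2 : ∀ n : ℤ, E1 q 0 ^ 2 * ∑' r : ℕ, F q m j (diag (n, r)) =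
      ∑' l : ℕ, g q m j n * (t1 q n.natAbs l * P q (2 * m + l)) := by
    intro n
    simp_rw [F_diag hq]
    rw [tsum_mul_left, mul_left_comm, S_eq hq, tsum_mul_left]
  simp_rw [h2]
  have hs : Summable (Function.uncurry fun (n : ℤ) (l : ℕ) =>
      g q m j n * (t1 q n.natAbs l * P q (2 * m + l))) := by
    refine summable_lin _ (fun p : ℤ × ℕ => p.1.natAbs + p.2) sz_int_nat (j ^ 2)
      (fun p => (Od_g hq m j p.1).mul ((Od_t1 hq _ p.2).mul (Od_P hq _))) fun p => ?_
    have h1 := bound_g hq m j p.1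
    have h2 := le_tri p.2
    have : (0 : ℤ) ≤ p.1.natAbs * p.2 := by positivity
    push_cast at *
    linarith
  rw [← hs.tsum_comm]
  refine tsum_congr fun l => ?_
  unfold G
  rw [← tsum_mul_left]
  refine tsum_congr fun n => ?_
  simp only [g, t1]
  have e : q ^ (tri (n.natAbs : ℤ) + n.natAbs * m + n * j) * q ^ (tri (l : ℤ) + n.natAbs * l) =
      q ^ tri (l : ℤ) * q ^ (tri (n.natAbs : ℤ) + n.natAbs * (m + l : ℕ) + n * j) := by
    rw [← zpow_add₀ (q_ne hq), ← zpow_add₀ (q_ne hq)]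
    congr 1
    push_cast; ring
  linear_combination (-1) ^ l * (-1) ^ n.natAbs * u q l * P q (2 * m + l) * e

def Phi (q : K) (b : ℕ → ℕ → K) (a : ℕ → K) (j : ℤ) (k m : ℕ) : K :=
  b k m * a m * (-1) ^ ((k : ℤ) + j) * q ^ tri k * G q k j

lemma mainB [CompleteSpace K] (b : ℕ → ℕ → K) (a : ℕ → K) (C : ℤ) (j : ℤ)
    (hb : ∀ m l : ℕ, b (m + l) m = q ^ (-((m : ℤ) * l)) * P q (2 * m + l) * u q l * u q (2 * m : ℕ))
    (hb0 : ∀ k m : ℕ, k < m → b k m = 0)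
    (ha : ∀ m : ℕ, Od (1 + m - tri m + C) (a m)) :
    Summable (fun k : ℕ => (∑ m ∈ Finset.range (k + 1), b k m * a m) * (-1) ^ ((k : ℤ) + j) *
      q ^ tri k * G q k j) ∧
    ∑' k : ℕ, (∑ m ∈ Finset.range (k + 1), b k m * a m) * (-1) ^ ((k : ℤ) + j) *
      q ^ tri k * G q k j =
      E1 q 0 ^ 3 * ∑' m : ℕ, a m * ((-1) ^ ((m : ℤ) + j) * q ^ tri m * (u q (m + j) * u q (m - j))) := by
  have hO : ∀ m l : ℕ, Od (tri l + m + 1 + C - j ^ 2) (Phi q b a j (m + l) m) := by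
    intro m l
    have h1 : Od (-((m : ℤ) * l)) (b (m + l) m) := by
      rw [hb]
      have := (((Od.qp hq (-((m : ℤ) * l))).mul (Od_P hq (2 * m + l))).mul (Od_u hq l)).mul
        (Od_u hq (2 * m : ℕ))
      simpa only [add_zero] using this
    have := ((((h1.mul (ha m)).mul (Od.sgn (((m + l : ℕ) : ℤ) + j))).mul
      (Od.qp hq (tri ((m + l : ℕ) : ℤ)))).mul (Od_G hq (m + l) j))
    refine Od.mono this ?_
    push_cast
    rw [tri_add]
    linarith
  have hs : Summable (Function.uncurry (Phi q b a j)) := by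
    refine summable_lin (fun p => if p.2 ≤ p.1 then tri ((p.1 - p.2 : ℕ) : ℤ) + p.2 + 1 + C - j ^ 2
      else p.1 + p.2)
      (fun p => p.1 + p.2) sz_nat2 (2 * (|C| + j ^ 2)) (fun p => ?_) (fun p => ?_)
    · obtain ⟨k, m⟩ := p
      simp only [Function.uncurry]
      split_ifs with h
      · obtain ⟨l, rfl⟩ := Nat.exists_eq_add_of_le h
        rw [Nat.add_sub_cancel_left]
        exact hO m l
      · rw [Phi, hb0 k m (by omega)]
        simp only [zero_mul]
        exact Od.zero
    · have h1 := neg_abs_le C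
      have h2 := sq_nonneg j
      have h3 := abs_nonneg C
      have h4 := le_tri ((p.1 - p.2 : ℕ) : ℤ)
      push_cast
      split_ifs with h
      · push_cast [h] at h4 ⊢
        linarith
      · linarith
  have hrow : ∀ k : ℕ, ∑' m : ℕ, Phi q b a j k m =
      (∑ m ∈ Finset.range (k + 1), b k m * a m) * (-1) ^ ((k : ℤ) + j) * q ^ tri k * G q k j := by
    intro k
    rw [tsum_eq_sum (s := Finset.range (k + 1))]
    · simp only [Phi, Finset.sum_mul]
    · intro m hm
      simp only [Finset.mem_range, not_lt] at hm
      rw [Phi, hb0 k m (by omega)]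
      simp only [zero_mul]
  have hcol : ∀ m : ℕ, ∑' k : ℕ, Phi q b a j k m =
      E1 q 0 ^ 3 * (a m * ((-1) ^ ((m : ℤ) + j) * q ^ tri m * (u q (m + j) * u q (m - j)))) := by
    intro m
    have h1 : Summable fun k => Phi q b a j k m :=
      hs.comp_injective (i := fun k => (k, m)) (fun x y h => by simpa using h)
    rw [← h1.sum_add_tsum_nat_add m, Finset.sum_eq_zero, zero_add]
    · have hk := keyA hq m j
      have hP := P_u hq (2 * m)
      have h2 : E1 q 0 ^ 3 * (a m * ((-1) ^ ((m : ℤ) + j) * q ^ tri m * (u q (m + j) * u q (m - j))))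
        = a m * (-1) ^ ((m : ℤ) + j) * q ^ tri m * u q (2 * m : ℕ) *
          (E1 q 0 ^ 3 * (u q (m + j) * u q (m - j) * P q (2 * m))) := by
        linear_combination (- E1 q 0 ^ 3 * (a m * ((-1) ^ ((m : ℤ) + j) * q ^ tri m *
          (u q (m + j) * u q (m - j))))) * hP
      rw [h2, hk, ← tsum_mul_left]
      refine tsum_congr fun l => ?_
      rw [add_comm l m, Phi, hb]
      push_cast
      have e1 : q ^ (-((m : ℤ) * l)) * q ^ tri ((m : ℤ) + l) = q ^ tri (m : ℤ) * q ^ tri (l : ℤ) := by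
        rw [← zpow_add₀ (q_ne hq), ← zpow_add₀ (q_ne hq), tri_add]
        congr 1
        ring
      have e2 : (-1 : K) ^ ((m : ℤ) + l + j) = (-1) ^ ((m : ℤ) + j) * (-1) ^ l := by
        rw [← zpow_natCast, ← zpow_add₀ (by simp)]
        congr 1
        ring
      rw [e2]
      linear_combination (a m * (-1) ^ ((m : ℤ) + j) * (-1) ^ l * P q (2 * m + l) * u q l *
        u q (2 * (m : ℤ)) * G q (m + l) j) * e1
    · intro k hk
      rw [Phi, hb0 k m (by simpa using hk)]
      simp only [zero_mul]
  constructor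
  · simp_rw [← hrow]
    exact hs.prod
  · simp_rw [← hrow]
    rw [← hs.tsum_comm]
    simp_rw [hcol]
    rw [tsum_mul_left]

lemma bq_eq (m l : ℕ) :
    q ^ ((m : ℤ) * ((m : ℤ) - ((m + l : ℕ) : ℤ))) *
    (∏ j ∈ Finset.range (2 * m), (q ^ ((m : ℤ) + (m + l : ℕ) - j) - 1)) *
    (∏ j ∈ Finset.range (2 * m), (q ^ ((2 * m : ℤ) - j) - 1))⁻¹ =
    q ^ (-((m : ℤ) * l)) * P q (2 * m + l) * u q l * u q (2 * m : ℕ) := by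
  have h : ∀ c : ℕ, ∏ j ∈ Finset.range (2 * m), (q ^ ((2 * m : ℤ) + c - j) - 1) =
      u q c * P q (c + 2 * m) := by
    intro c
    rw [← P_prod hq, ← Finset.prod_range_reflect]
    have : ∏ i ∈ Finset.range (2 * m), (1 - q ^ ((c : ℤ) + 1 + i)) =
        ∏ i ∈ Finset.range (2 * m), (-1) * (q ^ ((c : ℤ) + 1 + i) - 1) :=
      Finset.prod_congr rfl fun i _ => by ring
    rw [this, Finset.prod_mul_distrib, Finset.prod_const, Finset.card_range,
      Even.neg_one_pow (even_two_mul m), one_mul]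
    refine Finset.prod_congr rfl fun i hi => ?_
    simp only [Finset.mem_range] at hi
    congr 2
    omega
  have h1 := h l
  have h0 := h 0
  simp only [Nat.cast_zero, add_zero, zero_add, u_zero, one_mul] at h0
  rw [h0]
  rw [show (∏ j ∈ Finset.range (2 * m), (q ^ ((m : ℤ) + (m + l : ℕ) - j) - 1)) =
    u q l * P q (l + 2 * m) by
      rw [← h1]
      refine Finset.prod_congr rfl fun i hi => ?_
      congr 2
      push_cast; ring]
  rw [u_nat (2 * m), add_comm l]
  rw [show (m : ℤ) * ((m : ℤ) - ((m + l : ℕ) : ℤ)) = -((m : ℤ) * l) by push_cast; ring]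
  ring

lemma G_eq [CompleteSpace K] (k : ℕ) (j : ℤ) :
    Summable (fun n : ℕ =>
        (-1 : K) ^ (n + 1) *
          q ^ (((n : ℤ) + 1) * ((n : ℤ) + 2) / 2 + ((n : ℤ) + 1) * (k : ℤ)) *
          (q ^ (((n : ℤ) + 1) * j) + q ^ (-((n : ℤ) + 1) * j))) ∧
    G q k j = 1 + ∑' n : ℕ,
        (-1 : K) ^ (n + 1) *
          q ^ (((n : ℤ) + 1) * ((n : ℤ) + 2) / 2 + ((n : ℤ) + 1) * (k : ℤ)) *
          (q ^ (((n : ℤ) + 1) * j) + q ^ (-((n : ℤ) + 1) * j)) := by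
  have hs := summable_g hq k j
  have h1 : Summable fun n : ℕ => g q k j ((n : ℤ) + 1) :=
    hs.comp_injective (i := fun n : ℕ => (n : ℤ) + 1) (fun x y h => by simpa using h)
  have h2 : Summable fun n : ℕ => g q k j (-((n : ℤ) + 1)) :=
    hs.comp_injective (i := fun n : ℕ => -((n : ℤ) + 1)) (fun x y h => by simpa using h)
  have hG := (HasSum.of_add_one_of_neg_add_one h1.hasSum h2.hasSum).tsum_eq
  have e : (fun n : ℕ =>
        (-1 : K) ^ (n + 1) *
          q ^ (((n : ℤ) + 1) * ((n : ℤ) + 2) / 2 + ((n : ℤ) + 1) * (k : ℤ)) *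
          (q ^ (((n : ℤ) + 1) * j) + q ^ (-((n : ℤ) + 1) * j))) =
      fun n : ℕ => g q k j ((n : ℤ) + 1) + g q k j (-((n : ℤ) + 1)) := by
    funext n
    simp only [g, Int.natAbs_neg]
    have : ((n : ℤ) + 1).natAbs = n + 1 := by omega
    rw [this]
    have ht : ((n : ℤ) + 1) * ((n : ℤ) + 2) / 2 = tri ((n + 1 : ℕ) : ℤ) := by
      simp only [tri]; push_cast; ring_nf
    rw [ht]
    push_cast
    rw [zpow_add₀ (q_ne hq) _ (((n : ℤ) + 1) * j), zpow_add₀ (q_ne hq) _ (-((n : ℤ) + 1) * j)]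
    ring
  rw [e]
  refine ⟨h1.add h2, ?_⟩
  rw [h1.tsum_add h2, G, hG]
  have : g q k j 0 = 1 := by simp [g, tri_zero]
  rw [this]; ring

omit hq

end abs

end GM

lemma GM.hqq : Valued.v qq = (WithZero.exp (-1) : WithZero (Multiplicative ℤ)) :=
  LaurentSeries.valuation_single_zpow ℚ 1

lemma GM.ρ_eq (k : ℕ) (j : ℤ) : ρ k j = -(qq ^ GM.tri j) * ((-1) ^ ((k : ℤ) + j) * qq ^ GM.tri k *
    (GM.u qq (k + j) * GM.u qq (k - j))) := by
  unfold ρ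
  split_ifs with h
  · rcases lt_abs.1 h with h | h
    · rw [GM.u_neg (n := (k : ℤ) - j) (by omega)]; simp
    · rw [GM.u_neg (n := (k : ℤ) + j) (by omega)]; simp
  · rw [not_lt, abs_le] at h
    rw [GM.u, GM.u, if_pos (by omega), if_pos (by omega)]
    change -((-1) ^ ((k : ℤ) + j) * qq ^ (GM.tri k + GM.tri j) * (GM.P qq _ * GM.P qq _)⁻¹) = _
    rw [zpow_add₀ (GM.q_ne GM.hqq), mul_inv]
    ring

/-!
STATEMENT 14: Let (a_{−k−1})_{k≥0} be a sequence in ℚ((q)) satisfying the lower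
bound condition, with residue series r_j, and set
f_k = Σ_{k'=0}^{k} binom[k'+k, 2k']·a_{−k'−1}.  Then for every j ∈ ℤ,
r_j = −q^{j(j+1)/2}·((q)_∞)⁻³ · Σ_{k=0}^{∞} f_k·(−1)^{k+j}·q^{k(k+1)/2}·
  (1 + Σ_{n=1}^{∞} (−1)ⁿ·q^{n(n+1)/2+n·k}·(q^{n·j} + q^{−n·j})),
where all families appearing are summable in ℚ((q)).
-/

theorem residues_from_GM_coefficients
    (a : ℕ → LaurentSeries ℚ) (C : ℤ) (h : LBC a C)
    (f : ℕ → LaurentSeries ℚ)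
    (hf : ∀ k : ℕ, f k = ∑ k' ∈ Finset.range (k + 1), bq k k' * a k') :
    ∀ j : ℤ,
      (∀ k : ℕ, Summable (fun n : ℕ =>
        (-1 : LaurentSeries ℚ) ^ (n + 1) *
          qq ^ (((n : ℤ) + 1) * ((n : ℤ) + 2) / 2 + ((n : ℤ) + 1) * (k : ℤ)) *
          (qq ^ (((n : ℤ) + 1) * j) + qq ^ (-((n : ℤ) + 1) * j)))) ∧
      Summable (fun k : ℕ =>
        f k * (-1 : LaurentSeries ℚ) ^ ((k : ℤ) + j) * qq ^ ((k : ℤ) * ((k : ℤ) + 1) / 2) *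
          (1 + ∑' n : ℕ,
            (-1 : LaurentSeries ℚ) ^ (n + 1) *
              qq ^ (((n : ℤ) + 1) * ((n : ℤ) + 2) / 2 + ((n : ℤ) + 1) * (k : ℤ)) *
              (qq ^ (((n : ℤ) + 1) * j) + qq ^ (-((n : ℤ) + 1) * j)))) ∧
      resid a j = -(qq ^ (j * (j + 1) / 2)) * (qInf ^ 3)⁻¹ *
        ∑' k : ℕ,
          f k * (-1 : LaurentSeries ℚ) ^ ((k : ℤ) + j) * qq ^ ((k : ℤ) * ((k : ℤ) + 1) / 2) *
            (1 + ∑' n : ℕ,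
              (-1 : LaurentSeries ℚ) ^ (n + 1) *
                qq ^ (((n : ℤ) + 1) * ((n : ℤ) + 2) / 2 + ((n : ℤ) + 1) * (k : ℤ)) *
                (qq ^ (((n : ℤ) + 1) * j) + qq ^ (-((n : ℤ) + 1) * j))) := by
  intro j
  have hq := GM.hqq
  have hG := fun k => GM.G_eq hq k j
  refine ⟨fun k => (hG k).1, ?_⟩
  simp_rw [← fun k => (hG k).2]
  have ha : ∀ m : ℕ, GM.Od (1 + m - GM.tri m + C) (a m) := by
    intro m
    unfold GM.Od
    rw [LaurentSeries.valuation_le_iff_coeff_lt_eq_zero]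
    intro w hw
    apply h m w
    have := GM.two_tri m
    linarith
  have hb0 : ∀ k m : ℕ, k < m → bq k m = 0 := by
    intro k m hkm
    unfold bq
    rw [Finset.prod_eq_zero (i := m + k) (by simp; omega)]
    · simp
    · simp
  have hB := GM.mainB hq bq a C j (fun m l => GM.bq_eq hq m l) hb0 ha
  simp_rw [← hf] at hB
  refine ⟨hB.1, ?_⟩
  have hB2 := hB.2
  change _ = -(qq ^ GM.tri j) * (qInf ^ 3)⁻¹ * ∑' k : ℕ, f k * (-1) ^ ((k : ℤ) + j) *
    qq ^ GM.tri k * GM.G qq k j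
  rw [hB2]
  have hI : qInf = GM.E1 qq 0 := (GM.hasProd_E1 hq).tprod_eq
  have hne : GM.E1 qq 0 ≠ 0 := GM.E1_ne hq
  rw [hI, resid]
  simp_rw [GM.ρ_eq, mul_left_comm (a _)]
  rw [tsum_mul_left, mul_assoc, ← mul_assoc _ (GM.E1 qq 0 ^ 3), inv_mul_cancel₀ (pow_ne_zero 3 hne),
    one_mul]
end
end
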